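/- (Noether–Deuring) Let K be a field, A a finite-dimensional associative K-algebra, and K'/K a field extension. Let M and N be A-modules that are finite-dimensional as K-vector spaces. If M ⊗_K K' and N ⊗_K K' are isomorphic as modules over A ⊗_K K', then M and N are isomorphic as A-modules. -/

import Mathlib

open TensorProduct

/-- The action of `a : A` on an `A`-module `M`, viewed as a `K`-linear endomorphism. -/
def actionLinearMap (K : Type*) {A M : Type*} [CommRing K] [Ring A] [Algebra K A]
    [AddCommGroup M] [Module K M] [Module A M] [IsScalarTower K A M] (a : A) :
    M →ₗ[K] M where
  toFun m := a • m
  map_add' := smul_add a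
  map_smul' c m := smul_comm a c m

universe u

/-- The `K'`-linear maps `K' ⊗[K] M → K' ⊗[K] N` which commute with the action of `A`. -/
def equivariantHom (K K' A M N : Type*) [Field K] [Field K'] [Algebra K K'] [Ring A] [Algebra K A]
    [AddCommGroup M] [AddCommGroup N] [Module K M] [Module K N] [Module A M] [Module A N]
    [IsScalarTower K A M] [IsScalarTower K A N] :
    Submodule K' ((K' ⊗[K] M) →ₗ[K'] (K' ⊗[K] N)) where
  carrier := {T | ∀ a : A, T ∘ₗ (actionLinearMap K (M := M) a).baseChange K' =
    (actionLinearMap K (M := N) a).baseChange K' ∘ₗ T}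
  add_mem' hS hT a := by rw [LinearMap.add_comp, LinearMap.comp_add, hS a, hT a]
  zero_mem' a := by rw [LinearMap.zero_comp, LinearMap.comp_zero]
  smul_mem' c T hT a := by rw [LinearMap.smul_comp, LinearMap.comp_smul, hT a]

section BaseChange

variable {K K' A M N : Type*} [Field K] [Field K'] [Algebra K K'] [Ring A] [Algebra K A]
  [AddCommGroup M] [AddCommGroup N] [Module K M] [Module K N] [Module A M] [Module A N]
  [IsScalarTower K A M] [IsScalarTower K A N]

theorem baseChange_mem_equivariantHom (f : M →ₗ[A] N) :
    (f.restrictScalars K).baseChange K' ∈ equivariantHom K K' A M N := by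
  intro a
  rw [← LinearMap.baseChange_comp, ← LinearMap.baseChange_comp]
  congr 1
  ext m
  exact map_smul f a m

/-- The `i`-th coordinate of an equivariant map, with respect to a basis of `K'` over `K`. -/
noncomputable def coordHom {ι : Type*} [DecidableEq ι] (b : Module.Basis ι K K')
    (T : (K' ⊗[K] M) →ₗ[K'] (K' ⊗[K] N)) (hT : T ∈ equivariantHom K K' A M N) (i : ι) :
    M →ₗ[A] N where
  toFun m := TensorProduct.equivFinsuppOfBasisLeft b (T (1 ⊗ₜ m)) i
  map_add' x y := by simp [TensorProduct.tmul_add]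
  map_smul' a m := by
    have h : T (1 ⊗ₜ (a • m)) = (actionLinearMap K (M := N) a).baseChange K' (T (1 ⊗ₜ m)) :=
      LinearMap.congr_fun (hT a) (1 ⊗ₜ m)
    rw [h]
    induction T (1 ⊗ₜ m) using TensorProduct.induction_on with
    | zero => simp
    | tmul c n =>
      simp only [LinearMap.baseChange_tmul, TensorProduct.equivFinsuppOfBasisLeft_apply_tmul_apply,
        RingHom.id_apply]
      exact (smul_comm _ _ _)
    | add x y hx hy => simp only [map_add, Finsupp.add_apply, hx, hy, smul_add]

variable (K K' A M N) in
theorem span_baseChange_eq_equivariantHom [FiniteDimensional K M] :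
    Submodule.span K' (Set.range fun f : M →ₗ[A] N ↦ (f.restrictScalars K).baseChange K') =
      equivariantHom K K' A M N := by
  classical
  refine le_antisymm (Submodule.span_le.2 ?_) fun T hT ↦ ?_
  · rintro _ ⟨f, rfl⟩
    exact baseChange_mem_equivariantHom f
  let b := Module.Basis.ofVectorSpace K K'
  let v := Module.finBasis K M
  let s := Finset.univ.biUnion fun j ↦
    (TensorProduct.equivFinsuppOfBasisLeft b (T (1 ⊗ₜ v j))).support
  have key : T = ∑ i ∈ s, b i • ((coordHom b T hT i).restrictScalars K).baseChange K' := by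
    refine (Algebra.TensorProduct.basis K' v).ext fun j ↦ ?_
    rw [Algebra.TensorProduct.basis_apply, LinearMap.sum_apply,
      ← (TensorProduct.equivFinsuppOfBasisLeft b).symm_apply_apply (T (1 ⊗ₜ v j)),
      TensorProduct.equivFinsuppOfBasisLeft_symm_apply, Finsupp.sum_of_support_subset (s := s)]
    · refine Finset.sum_congr rfl fun i _ ↦ ?_
      simp [coordHom, TensorProduct.smul_tmul']
    · exact Finset.subset_biUnion_of_mem
        (fun j ↦ (TensorProduct.equivFinsuppOfBasisLeft b (T (1 ⊗ₜ v j))).support)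
        (Finset.mem_univ j)
    · simp
  rw [key]
  exact Submodule.sum_mem _ fun i _ ↦
    Submodule.smul_mem _ _ (Submodule.subset_span ⟨coordHom b T hT i, rfl⟩)

variable (K A M N) in
theorem finiteDimensional_hom [FiniteDimensional K M] [FiniteDimensional K N] :
    FiniteDimensional K (M →ₗ[A] N) :=
  Module.Finite.of_injective (LinearMap.restrictScalarsₗ K A M N K)
    (LinearMap.restrictScalars_injective K)

variable (K K' A M N) in
theorem finrank_equivariantHom [FiniteDimensional K M] [FiniteDimensional K N] :
    Module.finrank K' (equivariantHom K K' A M N) = Module.finrank K (M →ₗ[A] N) := by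
  have := finiteDimensional_hom K A M N
  let b := Module.finBasis K (M →ₗ[A] N)
  let ρ := LinearMap.restrictScalarsₗ K A M N K
  let β := LinearMap.baseChangeHom K K' M N
  have : Module.FinitePresentation K M := Module.finitePresentation_of_finite K M
  have hβ : IsBaseChange K' β := Module.FinitePresentation.isBaseChange_map K M N K'
  have hli : LinearIndependent K' fun i ↦ β (ρ (b i)) := by
    have h₁ : LinearIndependent K fun i ↦ ρ (b i) :=
      b.linearIndependent.map' ρ (LinearMap.ker_eq_bot.2 (LinearMap.restrictScalars_injective K))
    have h₂ := Module.Flat.linearIndependent_one_tmul (S := K') h₁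
    let ε : (K' ⊗[K] (M →ₗ[K] N)) ≃ₗ[K'] ((K' ⊗[K] M) →ₗ[K'] (K' ⊗[K] N)) := hβ.equiv
    have h₃ := h₂.map_injOn ε.toLinearMap ε.injective.injOn
    convert h₃ using 2 with i
    simp [ε, IsBaseChange.equiv_tmul]
  have hspan : Submodule.span K' (Set.range fun i ↦ β (ρ (b i))) =
      equivariantHom K K' A M N := by
    rw [← span_baseChange_eq_equivariantHom]
    refine le_antisymm (Submodule.span_mono ?_) (Submodule.span_le.2 ?_)
    · rintro _ ⟨i, rfl⟩
      exact ⟨b i, rfl⟩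
    · rintro _ ⟨f, rfl⟩
      change β (ρ f) ∈ _
      rw [← b.sum_repr f, map_sum, map_sum]
      refine Submodule.sum_mem _ fun i _ ↦ ?_
      rw [map_smul, map_smul, ← algebraMap_smul K']
      exact Submodule.smul_mem _ _ (Submodule.subset_span ⟨i, rfl⟩)
  rw [← hspan, finrank_span_eq_card hli, Fintype.card_fin]

theorem comp_mem_equivariantHom {X : Type*} [AddCommGroup X] [Module K X] [Module A X]
    [IsScalarTower K A X] {S : (K' ⊗[K] M) →ₗ[K'] (K' ⊗[K] N)}
    {T : (K' ⊗[K] X) →ₗ[K'] (K' ⊗[K] M)} (hS : S ∈ equivariantHom K K' A M N)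
    (hT : T ∈ equivariantHom K K' A X M) : S ∘ₗ T ∈ equivariantHom K K' A X N := by
  intro a
  rw [LinearMap.comp_assoc, hT a, ← LinearMap.comp_assoc, hS a, LinearMap.comp_assoc]

theorem finrank_hom_le_of_equivariant (X : Type*) [AddCommGroup X] [Module K X] [Module A X]
    [IsScalarTower K A X] [FiniteDimensional K X] [FiniteDimensional K M] [FiniteDimensional K N]
    (e : (K' ⊗[K] M) ≃ₗ[K'] (K' ⊗[K] N))
    (he : e.toLinearMap ∈ equivariantHom K K' A M N) :
    Module.finrank K (X →ₗ[A] M) ≤ Module.finrank K (X →ₗ[A] N) := by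
  rw [← finrank_equivariantHom K K' A X M, ← finrank_equivariantHom K K' A X N]
  let Φ := (LinearMap.compRight K' (M := K' ⊗[K] X) e.toLinearMap).restrict
    (p := equivariantHom K K' A X M) (q := equivariantHom K K' A X N)
    fun T hT ↦ comp_mem_equivariantHom he hT
  refine LinearMap.finrank_le_finrank_of_injective (f := Φ) fun S T h ↦ ?_
  ext1
  have h' : e.toLinearMap ∘ₗ S.1 = e.toLinearMap ∘ₗ T.1 := congrArg Subtype.val h
  exact LinearMap.ext fun x ↦ e.injective (LinearMap.congr_fun h' x)

theorem symm_mem_equivariantHom {e : (K' ⊗[K] M) ≃ₗ[K'] (K' ⊗[K] N)}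
    (he : e.toLinearMap ∈ equivariantHom K K' A M N) :
    e.symm.toLinearMap ∈ equivariantHom K K' A N M := by
  intro a
  ext1
  ext n
  apply e.injective
  have := LinearMap.congr_fun (he a) (e.symm (1 ⊗ₜ n))
  simpa using this.symm

theorem finrank_hom_eq_of_equivariant (X : Type*) [AddCommGroup X] [Module K X] [Module A X]
    [IsScalarTower K A X] [FiniteDimensional K X] [FiniteDimensional K M] [FiniteDimensional K N]
    (e : (K' ⊗[K] M) ≃ₗ[K'] (K' ⊗[K] N))
    (he : e.toLinearMap ∈ equivariantHom K K' A M N) :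
    Module.finrank K (X →ₗ[A] M) = Module.finrank K (X →ₗ[A] N) :=
  le_antisymm (finrank_hom_le_of_equivariant X e he)
    (finrank_hom_le_of_equivariant X e.symm (symm_mem_equivariantHom he))

theorem nonempty_linearEquiv_of_infinite [Infinite K]
    [FiniteDimensional K M] [FiniteDimensional K N] (e : (K' ⊗[K] M) ≃ₗ[K'] (K' ⊗[K] N))
    (he : e.toLinearMap ∈ equivariantHom K K' A M N) : Nonempty (M ≃ₗ[A] N) := by
  have hdim : Module.finrank K M = Module.finrank K N := by
    simpa using e.finrank_eq
  let v := Module.finBasis K M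
  let w := (Module.finBasis K N).reindex (finCongr hdim.symm)
  rw [← span_baseChange_eq_equivariantHom, Submodule.mem_span_set'] at he
  obtain ⟨n, c, g, hg⟩ := he
  choose f hf using fun i ↦ (g i).2
  let B i := LinearMap.toMatrix v w ((f i).restrictScalars K)
  let P : Matrix _ _ (MvPolynomial (Fin n) K) :=
    ∑ i, (MvPolynomial.X i : MvPolynomial (Fin n) K) • (B i).map MvPolynomial.C
  have hP : P.det ≠ 0 := by
    intro h0
    have hdet := (e.isUnit_det (Algebra.TensorProduct.basis K' v)
      (Algebra.TensorProduct.basis K' w)).ne_zero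
    apply hdet
    rw [← map_zero (MvPolynomial.aeval (R := K) c), ← h0, AlgHom.map_det, ← hg]
    congr 1
    ext j k
    simp only [← hf, map_sum, map_smul, LinearMap.toMatrix_baseChange]
    simp [P, B, Matrix.sum_apply]
  obtain ⟨x, hx⟩ : ∃ x, MvPolynomial.eval x P.det ≠ 0 := by
    by_contra! h
    exact hP (MvPolynomial.funext fun x ↦ by rw [h x, map_zero])
  let φ : M →ₗ[A] N := ∑ i, x i • f i
  have hφ : IsUnit (LinearMap.toMatrix v w (φ.restrictScalars K)).det := by
    rw [isUnit_iff_ne_zero]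
    convert hx
    rw [RingHom.map_det]
    congr 1
    have : φ.restrictScalars K = ∑ i, x i • (f i).restrictScalars K := by
      ext m
      simp [φ]
    rw [this]
    ext j k
    simp only [map_sum, map_smul]
    simp [P, B, Matrix.sum_apply]
  exact ⟨LinearEquiv.ofBijective φ (LinearEquiv.ofIsUnitDet hφ).bijective⟩

end BaseChange

section Counting

variable {A : Type*} [Ring A]

/-- Linear maps with kernel `Y` are the same as injective linear maps on the quotient by `Y`. -/
def homKerEquiv {X M : Type*} [AddCommGroup X] [Module A X] [AddCommGroup M] [Module A M]
    (Y : Submodule A X) :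
    {f : X →ₗ[A] M // LinearMap.ker f = Y} ≃ {f : (X ⧸ Y) →ₗ[A] M // LinearMap.ker f = ⊥} where
  toFun f := ⟨Y.liftQ f.1 f.2.ge, Submodule.ker_liftQ_eq_bot _ _ _ f.2.le⟩
  invFun f := ⟨f.1 ∘ₗ Y.mkQ, by rw [LinearMap.ker_comp, f.2, Submodule.comap_bot, Y.ker_mkQ]⟩
  left_inv f := by ext; rfl
  right_inv f := by ext; rfl

theorem card_hom_eq_sum {X M : Type*} [AddCommGroup X] [Module A X] [AddCommGroup M] [Module A M]
    [Finite X] [Finite M] [Fintype (Submodule A X)] :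
    Nat.card (X →ₗ[A] M) =
      ∑ Y : Submodule A X, Nat.card {f : (X ⧸ Y) →ₗ[A] M // LinearMap.ker f = ⊥} := by
  have : Finite (X →ₗ[A] M) := DFunLike.finite _
  rw [← Nat.card_congr (Equiv.sigmaFiberEquiv fun f : X →ₗ[A] M ↦ LinearMap.ker f), Nat.card_sigma]
  exact Finset.sum_congr rfl fun Y _ ↦ Nat.card_congr (homKerEquiv Y)

/-- If two finite modules receive equally many homomorphisms from every finite module, they receive
equally many injective homomorphisms from every finite module. -/
theorem card_injective_hom_eq {M N : Type*} [AddCommGroup M] [Module A M] [AddCommGroup N]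
    [Module A N] [Finite M] [Finite N]
    (h : ∀ (X : Type u) [AddCommGroup X] [Module A X] [Finite X],
      Nat.card (X →ₗ[A] M) = Nat.card (X →ₗ[A] N))
    (X : Type u) [AddCommGroup X] [Module A X] [Finite X] :
    Nat.card {f : X →ₗ[A] M // LinearMap.ker f = ⊥} =
      Nat.card {f : X →ₗ[A] N // LinearMap.ker f = ⊥} := by
  classical
  induction hn : Nat.card X using Nat.strong_induction_on generalizing X with
  | _ n ih =>
  subst hn
  have : Finite (Submodule A X) := Finite.of_injective _ SetLike.coe_injective
  have (Y : Submodule A X) : Finite (X ⧸ Y) := Finite.of_surjective _ Y.mkQ_surjective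
  have := Fintype.ofFinite (Submodule A X)
  have hX := h X
  rw [card_hom_eq_sum, card_hom_eq_sum, ← Finset.add_sum_erase _ _ (Finset.mem_univ ⊥),
    ← Finset.add_sum_erase _ _ (Finset.mem_univ ⊥)] at hX
  rw [Finset.sum_congr rfl fun Y hY ↦ ih (Nat.card (X ⧸ Y)) ?_ (X ⧸ Y) rfl] at hX
  · rw [Nat.card_congr (homKerEquiv (M := M) (⊥ : Submodule A X)),
      Nat.card_congr (homKerEquiv (M := N) (⊥ : Submodule A X))]
    exact Nat.add_right_cancel hX
  · have hne : Y ≠ ⊥ := Finset.ne_of_mem_erase hY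
    have : Nontrivial Y := Submodule.nontrivial_iff_ne_bot.2 hne
    rw [Submodule.card_eq_card_quotient_mul_card Y]
    have h₁ : 1 < Nat.card Y := Finite.one_lt_card
    have h₂ : 0 < Nat.card (X ⧸ Y) := Nat.card_pos
    nlinarith

end Counting

theorem nonempty_linearEquiv_of_finite {K K' A M N : Type*} [Field K] [Field K'] [Algebra K K']
    [Ring A] [Algebra K A] [AddCommGroup M] [AddCommGroup N] [Module K M] [Module K N]
    [Module A M] [Module A N] [IsScalarTower K A M] [IsScalarTower K A N] [Finite K]
    [FiniteDimensional K M] [FiniteDimensional K N] (e : (K' ⊗[K] M) ≃ₗ[K'] (K' ⊗[K] N))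
    (he : e.toLinearMap ∈ equivariantHom K K' A M N) : Nonempty (M ≃ₗ[A] N) := by
  have : Finite M := Module.finite_of_finite K
  have : Finite N := Module.finite_of_finite K
  have hcard := card_injective_hom_eq (A := A) (M := M) (N := N) (fun X _ _ _ ↦ by
    let _ : Module K X := Module.compHom X (algebraMap K A)
    have : IsScalarTower K A X := IsScalarTower.of_algebraMap_smul fun _ _ ↦ rfl
    have := finiteDimensional_hom K A X M
    have := finiteDimensional_hom K A X N
    rw [Module.natCard_eq_pow_finrank (K := K) (V := X →ₗ[A] M),
      Module.natCard_eq_pow_finrank (K := K) (V := X →ₗ[A] N),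
      finrank_hom_eq_of_equivariant X e he]) M
  have : Finite (M →ₗ[A] M) := DFunLike.finite _
  have : Nonempty {f : M →ₗ[A] M // LinearMap.ker f = ⊥} := ⟨LinearMap.id, LinearMap.ker_id⟩
  have hpos : 0 < Nat.card {f : M →ₗ[A] N // LinearMap.ker f = ⊥} := hcard ▸ Nat.card_pos
  obtain ⟨⟨f, hf⟩⟩ := (Nat.card_pos_iff.1 hpos).1
  have hdim : Module.finrank K M = Module.finrank K N := by
    simpa using e.finrank_eq
  have hinj : Function.Injective (f.restrictScalars K) := (LinearMap.ker_eq_bot (f := f)).1 hf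
  exact ⟨LinearEquiv.ofBijective f
    ⟨hinj, (LinearMap.injective_iff_surjective_of_finrank_eq_finrank hdim).1 hinj⟩⟩


/-- (Noether–Deuring) Let `A` be a finite-dimensional algebra over a field `K`, let `K'/K`
be a field extension and let `M`, `N` be `A`-modules which are finite-dimensional over `K`.
If `K' ⊗[K] M` and `K' ⊗[K] N` are isomorphic as modules over `A ⊗[K] K'` (i.e. there is a
`K'`-linear equivalence commuting with the `A`-actions), then `M ≅ N` as `A`-modules. -/
theorem noether_deuring (K K' : Type*) [Field K] [Field K'] [Algebra K K']
    (A : Type*) [Ring A] [Algebra K A] [FiniteDimensional K A]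
    (M N : Type*) [AddCommGroup M] [AddCommGroup N]
    [Module K M] [Module K N] [Module A M] [Module A N]
    [IsScalarTower K A M] [IsScalarTower K A N]
    [FiniteDimensional K M] [FiniteDimensional K N]
    (e : (K' ⊗[K] M) ≃ₗ[K'] (K' ⊗[K] N))
    (he : ∀ a : A,
      e.toLinearMap ∘ₗ LinearMap.baseChange K' (actionLinearMap K (M := M) a) =
        LinearMap.baseChange K' (actionLinearMap K (M := N) a) ∘ₗ e.toLinearMap) :
    Nonempty (M ≃ₗ[A] N) := by
  rcases finite_or_infinite K with _ | _
  · exact nonempty_linearEquiv_of_finite e he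
  · exact nonempty_linearEquiv_of_infinite e he
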